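/- (Propagation bound for perturbed Euler–Maruyama, deterministic skeleton) Let Δ(ih) ∈ ℝ^m, i = 0,...,T/h, be nonnegative vectors such that Δ(0) has a single nonzero entry at position i⋆ of value D, and Δ((i+1)h) ⪯ (I + M)·Δ(ih), where M is the circulant tridiagonal m×m matrix with diagonal entries (C_σ + C_f + 1)h + C_f h² and off-diagonal (cyclically adjacent) entries C_f h + C_f h², all other entries zero (C_f, C_σ ≥ 0, h > 0). Then for any constant C_d > 0 and all j: Δ_j(ih) ≤ D · e^{-C_d·d(j,i⋆)} · e^{C₁(1+h)ih}, where C₁ = (e^{C_d} + e^{-C_d} + 1)(C_f + C_σ + 1) and d is the circular distance. -/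

import Mathlib

noncomputable section
open Real

/-- Circular (torus) distance between indices of `Fin m`. -/
def cdist (m : ℕ) (j i : Fin m) : ℕ :=
  min (((j : ℕ) : ℤ) - ((i : ℕ) : ℤ)).natAbs
    (min (((j : ℕ) : ℤ) - ((i : ℕ) : ℤ) + (m : ℤ)).natAbs
      (((i : ℕ) : ℤ) - ((j : ℕ) : ℤ) + (m : ℤ)).natAbs)

/-- Truncated exponential terms. -/
def phi (q : ℕ) (x : ℝ) : ℝ := x ^ q / (Nat.factorial q : ℝ)

/-- Shifted terms. -/
def psi : ℕ → ℝ → ℝ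
  | 0, _ => 0
  | q + 1, x => phi q x

/-- Indicator of divisibility by `m`. -/
def wt (m : ℕ) (n : ℤ) : ℝ := if (m : ℤ) ∣ n then 1 else 0

/-- Truncated heat kernel on the cycle. -/
def KK (m N : ℕ) (s : ℝ) (c : ℤ) : ℝ :=
  ∑ p ∈ Finset.range N, ∑ q ∈ Finset.range N, wt m (c + p - q) * (phi p s * phi q s)

lemma wt_nonneg (m : ℕ) (n : ℤ) : 0 ≤ wt m n := by unfold wt; split_ifs <;> norm_num

lemma wt_le_one (m : ℕ) (n : ℤ) : wt m n ≤ 1 := by unfold wt; split_ifs <;> norm_num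

lemma phi_nonneg (q : ℕ) {x : ℝ} (hx : 0 ≤ x) : 0 ≤ phi q x := by unfold phi; positivity

lemma psi_nonneg (q : ℕ) {x : ℝ} (hx : 0 ≤ x) : 0 ≤ psi q x := by
  cases q with
  | zero => simp [psi]
  | succ q => exact phi_nonneg q hx

lemma phi_zero (x : ℝ) : phi 0 x = 1 := by simp [phi]

lemma phi_succ (q : ℕ) (x : ℝ) : phi (q + 1) x * (q + 1) = phi q x * x := by
  unfold phi
  rw [Nat.factorial_succ, pow_succ]
  push_cast
  field_simp

lemma phi_sum_le (N : ℕ) {x : ℝ} (hx : 0 ≤ x) : ∑ q ∈ Finset.range N, phi q x ≤ exp x :=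
  Real.sum_le_exp_of_nonneg hx N

lemma pow_step (q : ℕ) {s y : ℝ} (hs : 0 ≤ s) (hy : 0 ≤ y) :
    s ^ (q + 1) + (q + 1) * y * s ^ q ≤ (s + y) ^ (q + 1) := by
  induction q with
  | zero => simp
  | succ q ih =>
    have h1 : (s ^ (q + 1) + (q + 1) * y * s ^ q) * (s + y) ≤ (s + y) ^ (q + 1) * (s + y) :=
      mul_le_mul_of_nonneg_right ih (by positivity)
    have h2 : 0 ≤ (q + 1) * y * s ^ q * y := by positivity
    rw [pow_succ (s + y) (q + 1)]
    refine le_trans ?_ h1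
    push_cast
    have : s ^ (q + 1 + 1) = s ^ q * s * s := by ring
    rw [this, pow_succ s q]
    nlinarith

lemma phi_step (q : ℕ) {s y : ℝ} (hs : 0 ≤ s) (hy : 0 ≤ y) :
    phi q s + y * psi q s ≤ phi q (s + y) := by
  cases q with
  | zero => simp [phi, psi]
  | succ q =>
    have h := pow_step q hs hy
    simp only [psi, phi]
    rw [Nat.factorial_succ]
    have hf : (0 : ℝ) < (Nat.factorial q : ℝ) := by positivity
    have : s ^ (q + 1) / (((q + 1) * Nat.factorial q : ℕ) : ℝ) + y * (s ^ q / (Nat.factorial q : ℝ))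
        = (s ^ (q + 1) + (q + 1) * y * s ^ q) / (((q + 1) * Nat.factorial q : ℕ) : ℝ) := by
      push_cast
      field_simp
    rw [this]
    gcongr

lemma sum_psi (N : ℕ) (s : ℝ) (f : ℕ → ℝ) :
    ∑ p ∈ Finset.range (N + 1), f p * psi p s = ∑ p ∈ Finset.range N, f (p + 1) * phi p s := by
  rw [Finset.sum_range_succ']
  simp [psi]

lemma sum_mono_range (N : ℕ) (f : ℕ → ℝ) (hf : ∀ p, 0 ≤ f p) :
    ∑ p ∈ Finset.range N, f p ≤ ∑ p ∈ Finset.range (N + 1), f p := by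
  rw [Finset.sum_range_succ]
  linarith [hf N]

lemma KK_step (m N : ℕ) {s y : ℝ} (hs : 0 ≤ s) (hy : 0 ≤ y) (c : ℤ) :
    KK m N s c + y * KK m N s (c + 1) + y * KK m N s (c - 1) ≤ KK m (N + 1) (s + y) c := by
  have hφ := fun q => phi_nonneg q hs
  have hψ := fun q => psi_nonneg q hs
  have hw := wt_nonneg m
  have h1 : ∑ p ∈ Finset.range (N+1), ∑ q ∈ Finset.range (N+1),
      (wt m (c + p - q) * (phi p s * phi q s) + y * ((wt m (c + p - q) * phi q s) * psi p s)
        + y * ((wt m (c + p - q) * phi p s) * psi q s)) ≤ KK m (N + 1) (s + y) c := by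
    unfold KK
    refine Finset.sum_le_sum fun p _ => Finset.sum_le_sum fun q _ => ?_
    have a := phi_step p hs hy
    have b := phi_step q hs hy
    have ab : (phi p s + y * psi p s) * (phi q s + y * psi q s) ≤ phi p (s+y) * phi q (s+y) :=
      mul_le_mul a b (by have := hφ q; have := hψ q; positivity)
        (phi_nonneg p (by positivity))
    have h0 : 0 ≤ y * psi p s * (y * psi q s) := by
      have := hψ p; have := hψ q; positivity
    calc _ = wt m (c + p - q) * (phi p s * phi q s + y * psi p s * phi q s + y * phi p s * psi q s) := by
            ring
      _ ≤ _ := mul_le_mul_of_nonneg_left (by nlinarith) (hw _)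
  refine le_trans ?_ h1
  simp only [Finset.sum_add_distrib, ← Finset.mul_sum]
  gcongr ?_ + y * ?_ + y * ?_
  · unfold KK
    refine le_trans (sum_mono_range N _ ?_) (Finset.sum_le_sum fun p _ => sum_mono_range N _ ?_)
    · intro p
      exact Finset.sum_nonneg fun q _ => mul_nonneg (hw _) (mul_nonneg (hφ _) (hφ _))
    · intro q
      exact mul_nonneg (hw _) (mul_nonneg (hφ _) (hφ _))
  · simp only [← Finset.sum_mul]
    rw [sum_psi N s (fun p => ∑ q ∈ Finset.range (N+1), wt m (c + p - q) * phi q s)]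
    unfold KK
    refine Finset.sum_le_sum fun p _ => ?_
    rw [Finset.sum_mul]
    refine le_trans (sum_mono_range N _ ?_) (le_of_eq ?_)
    · intro q
      exact mul_nonneg (hw _) (mul_nonneg (hφ _) (hφ _))
    · refine Finset.sum_congr rfl fun q _ => ?_
      rw [show c + 1 + (p:ℤ) - q = c + ((p + 1 : ℕ) : ℤ) - q by push_cast; ring]
      ring
  · unfold KK
    refine le_trans (sum_mono_range N _ ?_) (Finset.sum_le_sum fun p _ => ?_)
    · intro p
      exact Finset.sum_nonneg fun q _ => mul_nonneg (hw _) (mul_nonneg (hφ _) (hφ _))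
    · rw [sum_psi N s (fun q => wt m (c + p - q) * phi p s)]
      refine le_of_eq (Finset.sum_congr rfl fun q _ => ?_)
      rw [show c - 1 + (p:ℤ) - q = c + p - ((q + 1 : ℕ) : ℤ) by push_cast; ring]
      ring

/-- `2 φ_{q+1} ≤ φ_q + φ_{q+1} + φ_{q+2}`. -/
lemma phi_window (q : ℕ) {x : ℝ} (hx : 0 ≤ x) :
    2 * phi (q + 1) x ≤ phi q x + phi (q + 1) x + phi (q + 2) x := by
  have h1 := phi_succ q x
  have h2 := phi_succ (q + 1) x
  have h0 := phi_nonneg q hx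
  push_cast at h2
  have hq : (0 : ℝ) ≤ q := Nat.cast_nonneg q
  have e1 : phi (q + 1) x = phi q x * (x / (q + 1)) := by
    field_simp; linarith
  have e2 : phi (q + 2) x = phi q x * (x / (q + 1)) * (x / (q + 2)) := by
    rw [← e1]; field_simp
    have : phi (q + 1 + 1) x = phi (q + 2) x := rfl
    rw [this] at h2; linarith
  rw [e1, e2]
  have : x / (q + 1) ≤ 1 + x / (q + 1) * (x / (q + 2)) := by
    rw [div_mul_div_comm, div_le_iff₀ (by positivity), add_mul, div_mul_eq_mul_div,
      mul_div_assoc]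
    have : x * x * ((q + 1) / ((q + 1) * (q + 2) : ℝ)) = x * x / (q + 2) := by field_simp
    have h4 : x ≤ q + 1 + x * x / (q + 2) := by
      have : q + 1 + x * x / (q + 2) = ((q + 1) * (q + 2) + x * x) / (q + 2) := by field_simp
      rw [this, le_div_iff₀ (by positivity)]
      nlinarith [sq_nonneg (x - (q + 2) / 2), sq_nonneg ((q : ℝ))]
    rw [one_mul]
    linarith
  nlinarith

lemma inner_two {m : ℕ} (hm : 3 ≤ m) (a : ℤ) (N : ℕ) {x : ℝ} (hx : 0 ≤ x) :
    ∑ q ∈ Finset.range N, wt m (a - (q + 1 : ℕ)) * (2 * phi (q + 1) x) ≤ exp x := by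
  have hφ := fun q => phi_nonneg q hx
  have hw := wt_nonneg m
  refine le_trans ?_ (phi_sum_le (N + 2) hx)
  have h1 : ∑ q ∈ Finset.range N, wt m (a - (q + 1 : ℕ)) * (2 * phi (q + 1) x) ≤
      ∑ q ∈ Finset.range N, wt m (a - (q + 1 : ℕ)) * phi q x
      + ∑ q ∈ Finset.range N, wt m (a - (q + 1 : ℕ)) * phi (q + 1) x
      + ∑ q ∈ Finset.range N, wt m (a - (q + 1 : ℕ)) * phi (q + 2) x := by
    rw [← Finset.sum_add_distrib, ← Finset.sum_add_distrib]
    refine Finset.sum_le_sum fun q _ => ?_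
    have := mul_le_mul_of_nonneg_left (phi_window q hx) (hw (a - (q + 1 : ℕ)))
    linarith
  have A : ∑ q ∈ Finset.range N, wt m (a - (q + 1 : ℕ)) * phi q x ≤
      ∑ q ∈ Finset.range (N + 2), wt m (a - (q + 1 : ℕ)) * phi q x :=
    (sum_mono_range N _ fun q => mul_nonneg (hw _) (hφ _)).trans
      (sum_mono_range (N + 1) _ fun q => mul_nonneg (hw _) (hφ _))
  have B : ∑ q ∈ Finset.range N, wt m (a - (q + 1 : ℕ)) * phi (q + 1) x ≤
      ∑ q ∈ Finset.range (N + 2), wt m (a - q) * phi q x := by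
    refine le_trans ?_ (sum_mono_range (N + 1) _ fun q => mul_nonneg (hw _) (hφ _))
    rw [Finset.sum_range_succ']
    have := mul_nonneg (hw (a - (0 : ℕ))) (hφ 0)
    linarith
  have C : ∑ q ∈ Finset.range N, wt m (a - (q + 1 : ℕ)) * phi (q + 2) x ≤
      ∑ q ∈ Finset.range (N + 2), wt m (a - q + 1) * phi q x := by
    rw [Finset.sum_range_succ', Finset.sum_range_succ']
    have h2 := mul_nonneg (hw (a - (0 : ℕ) + 1)) (hφ 0)
    have h3 := mul_nonneg (hw (a - (0 + 1 : ℕ) + 1)) (hφ (0 + 1))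
    have : ∑ q ∈ Finset.range N, wt m (a - (q + 1 : ℕ)) * phi (q + 2) x =
      ∑ q ∈ Finset.range N, wt m (a - (q + 1 + 1 : ℕ) + 1) * phi (q + 1 + 1) x := by
      refine Finset.sum_congr rfl fun q _ => ?_
      rw [show a - ((q + 1 + 1 : ℕ) : ℤ) + 1 = a - ((q + 1 : ℕ) : ℤ) by push_cast; ring]
    linarith
  refine h1.trans ((add_le_add (add_le_add A B) C).trans ?_)
  rw [← Finset.sum_add_distrib, ← Finset.sum_add_distrib]
  refine Finset.sum_le_sum fun q _ => ?_
  rw [← add_mul, ← add_mul]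
  refine mul_le_of_le_one_left (hφ q) ?_
  have key : ∀ n : ℤ, wt m (n - 1) + wt m n + wt m (n + 1) ≤ 1 := by
    intro n
    have hab : ∀ k l : ℤ, k < l → l - k < 3 → (m : ℤ) ∣ k → (m : ℤ) ∣ l → False := by
      intro k l h1 h2 h3 h4
      have := Int.le_of_dvd (by omega) (dvd_sub h4 h3)
      omega
    unfold wt
    split_ifs with h1 h2 h3 h3 h2 h3 h3 <;> first
      | (norm_num; done)
      | (exfalso; exact hab _ _ (by omega) (by omega) h1 h2)
      | (exfalso; exact hab _ _ (by omega) (by omega) h1 h3)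
      | (exfalso; exact hab _ _ (by omega) (by omega) h2 h3)
  have := key (a - q)
  rw [show a - ((q + 1 : ℕ) : ℤ) = a - q - 1 by push_cast; ring]
  exact this

lemma phi_T {r s : ℝ} (hr : 1 ≤ r) (hs : 0 ≤ s) (d p q : ℕ) (h : p + d ≤ q) :
    r ^ d * (phi p s * phi q s) ≤ phi p (s / r) * phi q (s * r) := by
  have hr0 : 0 < r := by linarith
  have : phi p (s / r) * phi q (s * r) = r ^ (q - p) * (phi p s * phi q s) := by
    unfold phi
    obtain ⟨e, rfl⟩ : ∃ e, q = p + e := ⟨q - p, by omega⟩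
    rw [Nat.add_sub_cancel_left, div_pow, mul_pow, pow_add r]
    field_simp
  rw [this]
  refine mul_le_mul_of_nonneg_right ?_ (mul_nonneg (phi_nonneg _ hs) (phi_nonneg _ hs))
  exact pow_le_pow_right₀ hr (by omega)

lemma KK_bound {m : ℕ} (hm : 3 ≤ m) (N d : ℕ) {r s : ℝ} (hr : 1 ≤ r) (hs : 0 ≤ s) (c : ℤ)
    (hc : ¬ (m : ℤ) ∣ c) (hd : ∀ n : ℤ, (m : ℤ) ∣ c - n → d ≤ n.natAbs) :
    r ^ d * KK m N s c ≤ exp (s / r) * exp (s * r) := by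
  have hr0 : 0 < r := by linarith
  have hx : 0 ≤ s * r := by positivity
  have hz : 0 ≤ s / r := by positivity
  have hw := wt_nonneg m
  set T : ℕ → ℕ → ℝ := fun p q => phi p (s / r) * phi q (s * r) with hT
  have hT0 : ∀ p q, 0 ≤ T p q := fun p q => mul_nonneg (phi_nonneg _ hz) (phi_nonneg _ hx)
  have h1 : r ^ d * KK m N s c ≤
      ∑ p ∈ Finset.range N, ∑ q ∈ Finset.range N, (if p ≤ q then wt m (c + p - q) * T p q else 0)
      + ∑ p ∈ Finset.range N, ∑ q ∈ Finset.range N,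
        (if q < p then wt m (c + p - q) * T q p else 0) := by
    unfold KK
    rw [← Finset.sum_add_distrib, Finset.mul_sum]
    refine Finset.sum_le_sum fun p _ => ?_
    rw [← Finset.sum_add_distrib, Finset.mul_sum]
    refine Finset.sum_le_sum fun q _ => ?_
    by_cases hdv : (m : ℤ) ∣ c + p - q
    · have hw1 : wt m (c + p - q) = 1 := by simp [wt, hdv]
      have hdn := hd ((q : ℤ) - p) (by
        rw [show c - ((q : ℤ) - p) = c + p - q by ring]; exact hdv)
      rw [hw1]
      by_cases hpq : p ≤ q
      · rw [if_pos hpq, if_neg (by omega)]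
        have := phi_T hr hs d p q (by omega)
        simp only [hT]; linarith
      · rw [if_neg hpq, if_pos (by omega)]
        have := phi_T hr hs d q p (by omega)
        simp only [hT]; linarith
    · have hw0 : wt m (c + p - q) = 0 := by simp [wt, hdv]
      simp [hw0]
  have h2 : ∑ p ∈ Finset.range N, ∑ q ∈ Finset.range N,
        (if q < p then wt m (c + p - q) * T q p else 0)
      = ∑ p ∈ Finset.range N, ∑ q ∈ Finset.range N,
        (if p < q then wt m (c + q - p) * T p q else 0) := Finset.sum_comm
  rw [h2, ← Finset.sum_add_distrib] at h1
  refine h1.trans ?_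
  have h3 : ∀ p, ∑ q ∈ Finset.range N, ((if p ≤ q then wt m (c + p - q) else 0)
      + (if p < q then wt m (c + q - p) else 0)) * phi q (s * r) ≤ exp (s * r) := by
    intro p
    by_cases h2c : (m : ℤ) ∣ 2 * c
    · have hle : ∀ q : ℕ, ((if p ≤ q then wt m (c + p - q) else 0)
          + (if p < q then wt m (c + q - p) else 0)) ≤
          if q = 0 then 0 else 2 * wt m (c + p - q) := by
        intro q
        have e : wt m (c + q - p) = wt m (c + p - q) := by
          unfold wt
          have : (m : ℤ) ∣ c + q - p ↔ (m : ℤ) ∣ c + p - q := by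
            rw [show c + (q : ℤ) - p = 2 * c - (c + p - q) by ring]
            exact dvd_sub_right h2c
          simp only [this]
        rw [e]
        have := hw (c + p - q)
        by_cases hq : q = 0
        · subst hq
          rw [if_pos rfl, if_neg (by omega : ¬ p < 0)]
          by_cases hp : p ≤ 0
          · have : p = 0 := by omega
            subst this
            simp [wt, hc]
          · simp [hp]
        · rw [if_neg hq]
          split_ifs <;> linarith
      calc _ ≤ ∑ q ∈ Finset.range (N + 1),
            (if q = 0 then 0 else 2 * wt m (c + p - q)) * phi q (s * r) := by
            refine le_trans (Finset.sum_le_sum fun q _ =>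
              mul_le_mul_of_nonneg_right (hle q) (phi_nonneg q hx)) (sum_mono_range N _ ?_)
            intro q
            refine mul_nonneg ?_ (phi_nonneg q hx)
            have := hw (c + p - q)
            split_ifs <;> linarith
        _ = ∑ q ∈ Finset.range N, wt m (c + p - (q + 1 : ℕ)) * (2 * phi (q + 1) (s * r)) := by
            rw [Finset.sum_range_succ']
            simp only [if_true, zero_mul, add_zero]
            refine Finset.sum_congr rfl fun q _ => ?_
            rw [if_neg (by omega)]; ring
        _ ≤ _ := inner_two hm (c + p) N hx
    · refine le_trans (Finset.sum_le_sum fun q _ => ?_) (phi_sum_le N hx)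
      refine mul_le_of_le_one_left (phi_nonneg q hx) ?_
      have : wt m (c + p - q) + wt m (c + q - p) ≤ 1 := by
        unfold wt
        split_ifs with h4 h5
        · exfalso
          apply h2c
          have := dvd_add h4 h5
          rwa [show c + (p : ℤ) - q + (c + q - p) = 2 * c by ring] at this
        all_goals norm_num
      have := hw (c + p - q)
      have := hw (c + q - p)
      split_ifs <;> linarith
  calc _ = ∑ p ∈ Finset.range N, phi p (s / r) * ∑ q ∈ Finset.range N,
        ((if p ≤ q then wt m (c + p - q) else 0)
      + (if p < q then wt m (c + q - p) else 0)) * phi q (s * r) := by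
        refine Finset.sum_congr rfl fun p _ => ?_
        rw [← Finset.sum_add_distrib, Finset.mul_sum]
        refine Finset.sum_congr rfl fun q _ => ?_
        simp only [hT]
        split_ifs <;> ring
    _ ≤ ∑ p ∈ Finset.range N, phi p (s / r) * exp (s * r) :=
        Finset.sum_le_sum fun p _ => mul_le_mul_of_nonneg_left (h3 p) (phi_nonneg p hz)
    _ ≤ _ := by
        rw [← Finset.sum_mul]
        exact mul_le_mul_of_nonneg_right (phi_sum_le N hz) (exp_pos _).le

lemma KK_trivial (m N : ℕ) {r s : ℝ} (hr : 1 ≤ r) (hs : 0 ≤ s) (c : ℤ) :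
    KK m N s c ≤ exp (s / r) * exp (s * r) := by
  have hr0 : 0 < r := by linarith
  have h1 : KK m N s c ≤ exp s * exp s := by
    calc KK m N s c ≤ ∑ p ∈ Finset.range N, ∑ q ∈ Finset.range N, phi p s * phi q s := by
          refine Finset.sum_le_sum fun p _ => Finset.sum_le_sum fun q _ => ?_
          exact mul_le_of_le_one_left (mul_nonneg (phi_nonneg _ hs) (phi_nonneg _ hs))
            (wt_le_one _ _)
      _ = (∑ p ∈ Finset.range N, phi p s) * ∑ q ∈ Finset.range N, phi q s := by
          rw [Finset.sum_mul_sum]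
      _ ≤ _ := mul_le_mul (phi_sum_le N hs) (phi_sum_le N hs)
          (Finset.sum_nonneg fun q _ => phi_nonneg q hs) (exp_pos _).le
  refine h1.trans ?_
  rw [← exp_add, ← exp_add, exp_le_exp]
  have : s / r + s * r - (s + s) = s / r * (r - 1) ^ 2 := by field_simp; ring
  have : 0 ≤ s / r * (r - 1) ^ 2 := by positivity
  linarith

lemma wt_congr (m : ℕ) {a b : ℤ} (h : (m : ℤ) ∣ a - b) : wt m a = wt m b := by
  unfold wt
  have : (m : ℤ) ∣ a ↔ (m : ℤ) ∣ b := (dvd_iff_dvd_of_dvd_sub h)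
  simp only [this]

lemma KK_congr (m N : ℕ) (s : ℝ) {a b : ℤ} (h : (m : ℤ) ∣ a - b) : KK m N s a = KK m N s b := by
  unfold KK
  refine Finset.sum_congr rfl fun p _ => Finset.sum_congr rfl fun q _ => ?_
  rw [wt_congr m (a := a + p - q) (b := b + p - q) (by
    rwa [show a + (p : ℤ) - q - (b + p - q) = a - b by ring])]

lemma fin_succ_dvd {m : ℕ} [NeZero m] (j : Fin m) :
    (m : ℤ) ∣ ((j + 1 : Fin m) : ℕ) - (((j : ℕ) : ℤ) + 1) := by
  have h : ((j + 1 : Fin m) : ℕ) = ((j : ℕ) + 1) % m := by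
    rw [Fin.val_add, Fin.val_one', Nat.add_mod_mod]
  rw [h]
  push_cast
  exact Int.dvd_emod_sub_self

lemma fin_pred_dvd {m : ℕ} [NeZero m] (j : Fin m) :
    (m : ℤ) ∣ ((j - 1 : Fin m) : ℕ) - (((j : ℕ) : ℤ) - 1) := by
  have h := fin_succ_dvd (j - 1)
  rw [sub_add_cancel] at h
  obtain ⟨t, ht⟩ := h
  exact ⟨-t, by linarith⟩

lemma cdist_le {m : ℕ} (j i : Fin m) (n : ℤ) (h : (m : ℤ) ∣ ((j : ℕ) : ℤ) - ((i : ℕ) : ℤ) - n) :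
    cdist m j i ≤ n.natAbs := by
  obtain ⟨t, ht⟩ := h
  have hj := j.isLt
  have hi := i.isLt
  unfold cdist
  rcases lt_trichotomy t 0 with h | h | h
  · have : (m : ℤ) * t ≤ -m := by nlinarith
    omega
  · subst h
    have : (m : ℤ) * 0 = 0 := by ring
    omega
  · have : (m : ℤ) ≤ m * t := by nlinarith
    omega

lemma mulVec_le {m : ℕ} [NeZero m] (a b y : ℝ) (ha : a ≤ y) (hb : b ≤ y) (hb0 : 0 ≤ b)
    (v : Fin m → ℝ) (hv : ∀ j, 0 ≤ v j) (j : Fin m) :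
    (((1 : Matrix (Fin m) (Fin m) ℝ) + Matrix.of fun j k =>
      if k = j then a else if k = j + 1 ∨ k = j - 1 then b else 0).mulVec v) j
    ≤ (1 + y) * v j + y * v (j + 1) + y * v (j - 1) := by
  rw [Matrix.add_mulVec, Matrix.one_mulVec, Pi.add_apply]
  have hy : 0 ≤ y := hb0.trans hb
  have : (Matrix.of (fun j k : Fin m =>
      if k = j then a else if k = j + 1 ∨ k = j - 1 then b else 0)).mulVec v j ≤
      ∑ k, ((if k = j then y * v k else 0) + (if k = j + 1 then y * v k else 0)
        + (if k = j - 1 then y * v k else 0)) := by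
    unfold Matrix.mulVec dotProduct
    refine Finset.sum_le_sum fun k _ => ?_
    simp only [Matrix.of_apply]
    have h1 := mul_le_mul_of_nonneg_right ha (hv k)
    have h2 := mul_le_mul_of_nonneg_right hb (hv k)
    have h3 := mul_nonneg hy (hv k)
    split_ifs <;> first | linarith | (exfalso; tauto)
  simp only [Finset.sum_add_distrib, Finset.sum_ite_eq', Finset.mem_univ, if_true] at this
  linarith

lemma main_aux {m : ℕ} [NeZero m] (y D : ℝ) (hy : 0 ≤ y) (hD : 0 ≤ D)
    (istar : Fin m) (Δ : ℕ → (Fin m → ℝ))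
    (hΔ0 : ∀ j, Δ 0 j = if j = istar then D else 0)
    (hrec : ∀ i j, Δ (i + 1) j ≤ (1 + y) * Δ i j + y * Δ i (j + 1) + y * Δ i (j - 1))
    (i : ℕ) : ∀ j : Fin m,
      Δ i j ≤ D * exp (i * y) * KK m (i + 1) (i * y) (((j : ℕ) : ℤ) - ((istar : ℕ) : ℤ)) := by
  induction i with
  | zero =>
    intro j
    rw [hΔ0]
    split_ifs with h
    · subst h
      simp [KK, wt, phi]
    · have := wt_nonneg m (((j : ℕ) : ℤ) - ((istar : ℕ) : ℤ))
      simp [KK, phi]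
      positivity
  | succ i ih =>
    intro j
    set s : ℝ := i * y with hs
    have hs0 : 0 ≤ s := by positivity
    set c : ℤ := ((j : ℕ) : ℤ) - ((istar : ℕ) : ℤ) with hc
    have e : ((i + 1 : ℕ) : ℝ) * y = s + y := by push_cast; ring
    rw [e]
    have a0 := ih j
    have a1 := ih (j + 1)
    have a2 := ih (j - 1)
    rw [KK_congr m (i + 1) s (b := c + 1) (by
      have := fin_succ_dvd j
      convert this using 1; rw [hc]; ring)] at a1
    rw [KK_congr m (i + 1) s (b := c - 1) (by
      have := fin_pred_dvd j
      convert this using 1; rw [hc]; ring)] at a2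
    rw [← hc] at a0
    have st := KK_step m (i + 1) hs0 hy c
    have hK : ∀ c, 0 ≤ KK m (i + 1) s c := fun c =>
      Finset.sum_nonneg fun p _ => Finset.sum_nonneg fun q _ =>
        mul_nonneg (wt_nonneg _ _) (mul_nonneg (phi_nonneg _ hs0) (phi_nonneg _ hs0))
    have k0 := hK c
    have k1 := hK (c + 1)
    have k2 := hK (c - 1)
    set P := D * exp s with hP
    have hP0 : 0 ≤ P := by positivity
    have hexp : 1 + y ≤ exp y := by linarith [add_one_le_exp y]
    calc Δ (i + 1) j ≤ _ := hrec i j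
      _ ≤ (1 + y) * (P * KK m (i + 1) s c) + y * (P * KK m (i + 1) s (c + 1))
          + y * (P * KK m (i + 1) s (c - 1)) := by gcongr
      _ ≤ P * ((1 + y) * (KK m (i + 1) s c + y * KK m (i + 1) s (c + 1)
          + y * KK m (i + 1) s (c - 1))) := by
          have : 0 ≤ P * (y * (y * KK m (i + 1) s (c + 1) + y * KK m (i + 1) s (c - 1))) := by
            positivity
          linarith
      _ ≤ P * (exp y * KK m (i + 1 + 1) (s + y) c) := by gcongr
      _ = _ := by rw [hP, exp_add]; ring

lemma case_two (a b y D : ℝ) (ha : a ≤ y) (hb : b ≤ y) (hb0 : 0 ≤ b) (hD : 0 ≤ D)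
    (istar : Fin 2) (Δ : ℕ → (Fin 2 → ℝ))
    (hΔpos : ∀ i j, 0 ≤ Δ i j)
    (hΔ0 : ∀ j, Δ 0 j = if j = istar then D else 0)
    (hrec : ∀ i j, Δ (i + 1) j ≤ (((1 : Matrix (Fin 2) (Fin 2) ℝ) + Matrix.of fun j k =>
      if k = j then a else if k = j + 1 ∨ k = j - 1 then b else 0).mulVec (Δ i)) j)
    (r : ℝ) (hr : 1 ≤ r) (i : ℕ) : ∀ j : Fin 2,
      Δ i j ≤ D * (r ^ (cdist 2 j istar))⁻¹ * exp (i * (y * (r + 1))) := by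
  have hy : 0 ≤ y := hb0.trans hb
  have hr0 : 0 < r := by linarith
  have hri : r⁻¹ ≤ 1 := inv_le_one_of_one_le₀ hr
  have hri0 : 0 < r⁻¹ := by positivity
  have hrec' : ∀ i j, Δ (i + 1) j ≤ (1 + y) * Δ i j + y * Δ i (j + 1) := by
    intro i j
    have h := hrec i j
    have h0 := hΔpos i 0
    have h1 := hΔpos i 1
    fin_cases j <;>
      simp [Matrix.mulVec, dotProduct, Fin.sum_univ_two, Matrix.one_apply] at h ⊢ <;>
      nlinarith
  induction i with
  | zero =>
    intro j
    rw [hΔ0]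
    split_ifs with h
    · subst h; simp [cdist]
    · positivity
  | succ i ih =>
    intro j
    have hneigh : (r ^ (cdist 2 (j + 1) istar))⁻¹ ≤ r * (r ^ (cdist 2 j istar))⁻¹ := by
      fin_cases j <;> fin_cases istar <;> simp [cdist] <;>
        first | (field_simp; done) | nlinarith | (field_simp; nlinarith)
    set E := (r ^ (cdist 2 j istar))⁻¹
    have hE : 0 ≤ E := by positivity
    set X := exp (i * (y * (r + 1))) with hX
    have hexp : 1 + y * (r + 1) ≤ exp (y * (r + 1)) := by linarith [add_one_le_exp (y * (r + 1))]
    calc Δ (i + 1) j ≤ _ := hrec' i j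
      _ ≤ (1 + y) * (D * E * X) + y * (D * (r ^ (cdist 2 (j + 1) istar))⁻¹ * X) := by
        gcongr
        · exact ih j
        · exact ih (j + 1)
      _ ≤ (1 + y) * (D * E * X) + y * (D * (r * E) * X) := by gcongr
      _ = D * E * X * (1 + y * (r + 1)) := by ring
      _ ≤ D * E * X * exp (y * (r + 1)) := by gcongr
      _ = _ := by
        rw [hX, mul_assoc, ← exp_add]
        push_cast
        ring_nf

/-- Propagation bound for the deterministic skeleton of a perturbed Euler–Maruyama
recursion with circulant tridiagonal transition matrix. -/
theorem euler_skeleton_propagation {m : ℕ} [NeZero m]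
    (Cf Cσ h D : ℝ) (hCf : 0 ≤ Cf) (hCσ : 0 ≤ Cσ) (hh : 0 < h)
    (M : Matrix (Fin m) (Fin m) ℝ)
    (hMdef : M = Matrix.of fun j k =>
      if k = j then (Cσ + Cf + 1) * h + Cf * h ^ 2
      else if k = j + 1 ∨ k = j - 1 then Cf * h + Cf * h ^ 2
      else 0)
    (istar : Fin m)
    (Δ : ℕ → (Fin m → ℝ))
    (hΔpos : ∀ i j, 0 ≤ Δ i j)
    (hΔ0 : ∀ j, Δ 0 j = if j = istar then D else 0)
    (hrec : ∀ i j, Δ (i + 1) j ≤ (((1 : Matrix (Fin m) (Fin m) ℝ) + M).mulVec (Δ i)) j)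
    (C_d : ℝ) (hCd : 0 < C_d) :
    ∀ (i : ℕ) (j : Fin m),
      Δ i j ≤ D * exp (-C_d * (cdist m j istar : ℝ))
        * exp ((exp C_d + exp (-C_d) + 1) * (Cf + Cσ + 1) * (1 + h) * i * h) := by
  intro i j
  have hD : 0 ≤ D := by
    have := hΔpos 0 istar
    rw [hΔ0, if_pos rfl] at this
    exact this
  subst hMdef
  obtain ⟨y, hydef⟩ : ∃ y, y = (Cf + Cσ + 1) * (h + h ^ 2) := ⟨_, rfl⟩
  have hh2 : 0 < h ^ 2 := by positivity
  have ha : (Cσ + Cf + 1) * h + Cf * h ^ 2 ≤ y := by rw [hydef]; nlinarith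
  have hb : Cf * h + Cf * h ^ 2 ≤ y := by rw [hydef]; nlinarith
  have hb0 : 0 ≤ Cf * h + Cf * h ^ 2 := by positivity
  have hy : 0 ≤ y := hb0.trans hb
  obtain ⟨r, hrdef⟩ : ∃ r, r = exp C_d := ⟨_, rfl⟩
  have hr : 1 ≤ r := by rw [hrdef]; exact one_le_exp hCd.le
  have hr0 : 0 < r := by linarith
  have hE : exp (-C_d * (cdist m j istar : ℝ)) = (r ^ (cdist m j istar))⁻¹ := by
    rw [hrdef, ← exp_nat_mul, ← exp_neg]; congr 1; ring
  have hX : (exp C_d + exp (-C_d) + 1) * (Cf + Cσ + 1) * (1 + h) * i * h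
      = i * y + (i * y / r + i * y * r) := by
    rw [exp_neg, ← hrdef, hydef]; field_simp; ring
  rw [hE, hX]
  by_cases hm2 : m = 2
  · subst hm2
    have := case_two _ _ y D ha hb hb0 hD istar Δ hΔpos hΔ0
      (fun i j => by convert hrec i j) r hr i j
    refine this.trans ?_
    gcongr
    have : 0 ≤ i * y / r := by positivity
    linarith
  · have hs : 0 ≤ (i : ℝ) * y := by positivity
    have h1 := main_aux y D hy hD istar Δ hΔ0 (fun i j => (hrec i j).trans
      (mulVec_le _ _ y ha hb hb0 _ (hΔpos i) j)) i j
    have h2 : KK m (i + 1) (i * y) (((j : ℕ) : ℤ) - ((istar : ℕ) : ℤ)) ≤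
        (r ^ (cdist m j istar))⁻¹ * exp (i * y / r + i * y * r) := by
      rw [exp_add]
      by_cases hj : j = istar
      · have : cdist m j istar = 0 := by simp [cdist, hj]
        rw [this, pow_zero, inv_one, one_mul]
        exact KK_trivial m _ hr hs _
      · have hj1 := j.isLt
        have hi1 := istar.isLt
        have hne : (j : ℕ) ≠ istar := fun h => hj (Fin.ext h)
        rw [le_inv_mul_iff₀ (by positivity)]
        refine KK_bound (by omega) _ _ hr hs _ ?_ (fun n hn => cdist_le j istar n hn)
        intro hdv
        have := Int.eq_zero_of_abs_lt_dvd hdv (by rw [abs_lt]; constructor <;> omega)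
        omega
    calc Δ i j ≤ _ := h1
      _ ≤ D * exp (i * y) * ((r ^ (cdist m j istar))⁻¹ * exp (i * y / r + i * y * r)) := by
        gcongr
      _ = _ := by rw [exp_add (i * y)]; ring
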